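/- Let d be a positive integer and let Ω ⊆ ℝ^d be a locally compact set. Let ξ be any gauge and let ψ be a gauge with liminf_{r→0+} ψ(r)/r^{d-1} = 0. Then for a typical function f ∈ C(Ω) there is a partition Ω = A ∪ B (A and B disjoint) such that (i) the lower box-counting measure ν^ψ(A) = 0 and (ii) the Hausdorff measure H^ξ(f(B)) = 0. -/

import Mathlib

open Filter Set Topology MeasureTheory
open scoped ENNReal NNReal

noncomputable section

/-- A gauge: nondecreasing on `[0,∞)`, right-continuous, `φ 0 = 0`, positive on `(0,∞)`. -/
def IsGauge (φ : ℝ → ℝ) : Prop :=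
  (∀ ⦃a b : ℝ⦄, 0 ≤ a → a ≤ b → φ a ≤ φ b) ∧
  (∀ a : ℝ, 0 ≤ a → ContinuousWithinAt φ (Set.Ici a) a) ∧
  φ 0 = 0 ∧ (∀ r : ℝ, 0 < r → 0 < φ r)

/-- `N_δ(E)`: the least number of sets of diameter at most `δ` needed to cover `E`. -/
def coverNum {X : Type*} [PseudoMetricSpace X] (δ : ℝ) (E : Set X) : ℝ≥0∞ :=
  ⨅ (n : ℕ) (_ : ∃ F : Fin n → Set X,
    (∀ i, EMetric.diam (F i) ≤ ENNReal.ofReal δ) ∧ E ⊆ ⋃ i, F i), (n : ℝ≥0∞)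

/-- `ν_0^ζ(E) = liminf_{δ→0+} N_δ(E)·ζ(δ)`. -/
def nu0 {X : Type*} [PseudoMetricSpace X] (ζ : ℝ → ℝ) (E : Set X) : ℝ≥0∞ :=
  Filter.liminf (fun δ : ℝ => coverNum δ E * ENNReal.ofReal (ζ δ)) (𝓝[>] (0:ℝ))

/-- The lower box-counting measure `ν^ζ`. -/
def lowerBoxMeasure {X : Type*} [PseudoMetricSpace X] (ζ : ℝ → ℝ) (E : Set X) : ℝ≥0∞ :=
  ⨅ (G : ℕ → Set X) (_ : E ⊆ ⋃ n, G n), ∑' n, nu0 ζ (G n)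

/-- The lower box dimension `lbdim E = liminf_{r→0+} log N_r(E)/|log r|`. -/
def lbdim {X : Type*} [PseudoMetricSpace X] (E : Set X) : EReal :=
  Filter.liminf (fun r : ℝ => ENNReal.log (coverNum r E) * ((|Real.log r|⁻¹ : ℝ) : EReal))
    (𝓝[>] (0:ℝ))

/-- The lower packing dimension. -/
def lpdim {X : Type*} [PseudoMetricSpace X] (E : Set X) : EReal :=
  ⨅ (G : ℕ → Set X) (_ : E ⊆ ⋃ n, G n), ⨆ n, lbdim (G n)

/-- The generalized lower scaled oscillation `lip_φ f`. -/
def lipGauge {X : Type*} [PseudoMetricSpace X] (φ : ℝ → ℝ) (f : X → ℝ) (x : X) : ℝ≥0∞ :=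
  Filter.liminf
    (fun r : ℝ => EMetric.diam (f '' Metric.closedBall x r) / ENNReal.ofReal (φ r))
    (𝓝[>] (0:ℝ))

/-- The upper scaled oscillation `Lip f`. -/
def LipGauge {X : Type*} [PseudoMetricSpace X] (φ : ℝ → ℝ) (f : X → ℝ) (x : X) : ℝ≥0∞ :=
  Filter.limsup
    (fun r : ℝ => EMetric.diam (f '' Metric.closedBall x r) / ENNReal.ofReal (φ r))
    (𝓝[>] (0:ℝ))

/-- The Hausdorff measure with gauge `ξ`. -/
def hausdorffGauge {X : Type*} [PseudoMetricSpace X] (ξ : ℝ → ℝ) (E : Set X) : ℝ≥0∞ :=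
  ⨆ (δ : ℝ) (_ : 0 < δ), ⨅ (G : ℕ → Set X) (_ : E ⊆ ⋃ n, G n)
    (_ : ∀ n, EMetric.diam (G n) ≤ ENNReal.ofReal δ),
    ∑' n, ENNReal.ofReal (ξ (EMetric.diam (G n)).toReal)

/-- A box in `ℝ^k`. -/
def IsBox {k : ℕ} (S : Set (EuclideanSpace ℝ (Fin k))) : Prop :=
  ∃ a b : Fin k → ℝ, S = {x | ∀ i, x i ∈ Set.Icc (a i) (b i)}

/-- A microscopic subset of `ℝ^k`. -/
def Microscopic {k : ℕ} (X : Set (EuclideanSpace ℝ (Fin k))) : Prop :=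
  ∀ ε : ℝ, 0 < ε → ∃ B : ℕ → Set (EuclideanSpace ℝ (Fin k)),
    (∀ n, IsBox (B n)) ∧ X ⊆ ⋃ n, B n ∧
    ∀ n, MeasureTheory.volume (B n) ≤ ENNReal.ofReal (ε ^ (n + 1))

/-- A microscopic subset of `ℝ`. -/
def MicroscopicR (E : Set ℝ) : Prop :=
  ∀ ε : ℝ, 0 < ε → ∃ I : ℕ → ℝ × ℝ,
    E ⊆ ⋃ n, Set.Icc (I n).1 (I n).2 ∧
    ∀ n, MeasureTheory.volume (Set.Icc (I n).1 (I n).2) ≤ ENNReal.ofReal (ε ^ (n + 1))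

end

lemma coverNum_mono {X : Type*} [PseudoMetricSpace X] {δ : ℝ} {E E' : Set X} (h : E ⊆ E') :
    coverNum δ E ≤ coverNum δ E' := by
  refine le_iInf₂ fun n ⟨F, hF, hcov⟩ => iInf₂_le n ⟨F, hF, h.trans hcov⟩

/-- A set is covered by the fibres of a map with finitely many values. -/
lemma coverNum_le_card {X T : Type*} [PseudoMetricSpace X] {δ : ℝ} {E : Set X}
    (t : Finset T) (code : X → T) (hcode : ∀ x ∈ E, code x ∈ t)
    (hdist : ∀ x ∈ E, ∀ y ∈ E, code x = code y → dist x y ≤ δ) :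
    coverNum δ E ≤ t.card := by
  refine iInf₂_le t.card
    ⟨fun i => {x ∈ E | code x = t.equivFin.symm i}, fun i => ?_, fun x hx => ?_⟩
  · refine Metric.ediam_le fun x hx y hy => ?_
    rw [edist_dist]
    exact ENNReal.ofReal_le_ofReal (hdist x hx.1 y hy.1 (hx.2.trans hy.2.symm))
  · refine mem_iUnion.2 ⟨t.equivFin ⟨code x, hcode x hx⟩, hx, ?_⟩
    simp

lemma EuclideanSpace.dist_le_card_mul {ι : Type*} [Fintype ι] {x y : EuclideanSpace ℝ ι} {c : ℝ}
    (h : ∀ l, |x l - y l| ≤ c) : dist x y ≤ Fintype.card ι * c := by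
  rcases isEmpty_or_nonempty ι with hι | ⟨⟨i⟩⟩
  · simp [EuclideanSpace.dist_eq]
  have hc : 0 ≤ c := (abs_nonneg _).trans (h i)
  rw [EuclideanSpace.dist_eq]
  refine Real.sqrt_le_iff.2 ⟨by positivity, ?_⟩
  have hcard : (1 : ℝ) ≤ Fintype.card ι := by
    exact_mod_cast Fintype.card_pos_iff.2 ⟨i⟩
  calc ∑ l, dist (x l) (y l) ^ 2 ≤ ∑ _l : ι, c ^ 2 := by
        refine Finset.sum_le_sum fun l _ => ?_
        rw [Real.dist_eq]
        exact pow_le_pow_left₀ (abs_nonneg _) (h l) 2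
    _ = Fintype.card ι * c ^ 2 := by simp
    _ ≤ (Fintype.card ι * c) ^ 2 := by
        rw [mul_pow]
        exact mul_le_mul_of_nonneg_right (by nlinarith) (by positivity)

lemma abs_sub_lt_of_floor_div_eq {a b s c : ℝ} (hs : 0 < s) (h : ⌊a / s⌋ = ⌊b / s⌋)
    (hc : |Int.fract (a / s) - Int.fract (b / s)| < c / s) : |a - b| < c := by
  have ha := Int.floor_add_fract (a / s)
  have hb := Int.floor_add_fract (b / s)
  have key : a - b = s * (Int.fract (a / s) - Int.fract (b / s)) := by
    have : s * (a / s - b / s) = a - b := by field_simp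
    rw [← this]
    congr 1
    rw [h] at ha
    linarith
  rw [key, abs_mul, abs_of_pos hs]
  calc _ < s * (c / s) := by gcongr
    _ = c := by field_simp

lemma floor_mem_Icc_neg {a s R : ℝ} (hs : 0 < s) (ha : |a| ≤ R) {m : ℕ} (hm : R / s + 1 ≤ m) :
    ⌊a / s⌋ ∈ Finset.Icc (-(m : ℤ)) m := by
  obtain ⟨h1, h2⟩ := abs_le.1 ha
  have h3 : a / s ≤ R / s := by gcongr
  have h4 : -(R / s) ≤ a / s := by rw [← neg_div]; gcongr
  rw [Finset.mem_Icc]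
  constructor
  · rw [Int.le_floor]; push_cast; linarith
  · have := Int.floor_le (a / s)
    exact_mod_cast (show ((⌊a / s⌋ : ℤ) : ℝ) ≤ (m : ℤ) by push_cast; linarith)

/-- The part of a cube of side `2R` lying within `r / d` below the hyperplanes of a grid of mesh
`s` can be covered by `O(r ^ (1 - d))` sets of diameter `r`. -/
lemma exists_coverNum_grid_le (d : ℕ) (hd : 0 < d) (R s : ℝ) (hR : 0 ≤ R) (hs : 0 < s) :
    ∃ C : ℝ, 0 < C ∧ ∀ r : ℝ, 0 < r → r ≤ 1 →
      coverNum r {x : EuclideanSpace ℝ (Fin d) |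
        (∀ l, |x l| ≤ R) ∧ ∃ i, 1 - r / d / s < Int.fract (x i / s)} ≤
      ENNReal.ofReal (C / r ^ (d - 1)) := by
  classical
  obtain ⟨a, ha⟩ := exists_nat_ge (R / s + 1)
  have hd' : (1 : ℝ) ≤ d := by exact_mod_cast hd
  refine ⟨d * ((2 * a + 1) * ((2 * R + 5) * d) ^ (d - 1)), by positivity, fun r hr hr1 => ?_⟩
  set ρ : ℝ := r / d with hρ
  have hρ0 : 0 < ρ := by positivity
  have hρ1 : ρ ≤ 1 := (div_le_self hr.le hd').trans hr1
  set b : ℕ := ⌈R / ρ⌉₊ + 1 with hb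
  have hbR : R / ρ + 1 ≤ b := by
    rw [hb]; push_cast; linarith [Nat.le_ceil (R / ρ)]
  have hbR' : (b : ℝ) ≤ R / ρ + 2 := by
    rw [hb]; push_cast; linarith [Nat.ceil_lt_add_one (a := R / ρ) (by positivity)]
  set E := {x : EuclideanSpace ℝ (Fin d) |
        (∀ l, |x l| ≤ R) ∧ ∃ i, 1 - ρ / s < Int.fract (x i / s)} with hE
  have hidx : ∀ x : EuclideanSpace ℝ (Fin d), ∃ i : Fin d,
      x ∈ E → 1 - ρ / s < Int.fract (x i / s) := by
    intro x
    by_cases hx : x ∈ E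
    · obtain ⟨i, hi⟩ := hx.2
      exact ⟨i, fun _ => hi⟩
    · exact ⟨⟨0, hd⟩, fun h => absurd h hx⟩
  choose idx hidx using hidx
  let box : Fin d → Fin d → Finset ℤ := fun i =>
    Function.update (fun _ => Finset.Icc (-(b : ℤ)) b) i (Finset.Icc (-(a : ℤ)) a)
  let t : Finset (Fin d × (Fin d → ℤ)) :=
    Finset.univ.biUnion fun i => (Fintype.piFinset (box i)).image (Prod.mk i)
  let mesh : Fin d → Fin d → ℝ := fun i l => if l = i then s else ρ
  let code : EuclideanSpace ℝ (Fin d) → Fin d × (Fin d → ℤ) := fun x =>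
    (idx x, fun l => ⌊x l / mesh (idx x) l⌋)
  have hcard : (t.card : ℝ) ≤ d * ((2 * a + 1) * (2 * b + 1) ^ (d - 1)) := by
    have h1 : ∀ i : Fin d, (Fintype.piFinset (box i)).card = (2 * a + 1) * (2 * b + 1) ^ (d - 1) := by
      intro i
      have h2 : ∀ l, (box i l).card = Function.update (fun _ => 2 * b + 1) i (2 * a + 1) l := by
        intro l
        by_cases hl : l = i
        · subst hl; simp [box]; omega
        · simp [box, hl]; omega
      rw [Fintype.card_piFinset, Finset.prod_congr rfl fun l _ => h2 l,
        Finset.prod_update_of_mem (Finset.mem_univ i), Finset.prod_const,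
        Finset.card_sdiff_of_subset (Finset.subset_univ _)]
      simp
    have h3 : t.card ≤ d * ((2 * a + 1) * (2 * b + 1) ^ (d - 1)) := by
      refine (Finset.card_biUnion_le_card_mul _ _ _ fun i _ =>
        Finset.card_image_le.trans (h1 i).le).trans (by simp)
    exact_mod_cast h3
  have hmain : coverNum r E ≤ t.card := by
    refine coverNum_le_card t code (fun x hx => ?_) (fun x hx y hy hxy => ?_)
    · refine Finset.mem_biUnion.2 ⟨idx x, Finset.mem_univ _, Finset.mem_image.2 ⟨_, ?_, rfl⟩⟩
      refine Fintype.mem_piFinset.2 fun l => ?_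
      by_cases hl : l = idx x
      · simp only [mesh, box, hl, Function.update_self, if_true]
        exact floor_mem_Icc_neg hs (hx.1 _) ha
      · simp only [mesh, box, hl, Function.update_of_ne, if_false, ne_eq, not_false_eq_true]
        exact floor_mem_Icc_neg hρ0 (hx.1 _) hbR
    · obtain ⟨hi, hfl⟩ := Prod.mk.inj hxy
      have hxi := hidx x hx
      have hyi := hidx y hy
      rw [← hi] at hyi hfl
      have hle : ∀ l, |x l - y l| ≤ ρ := by
        intro l
        have hl' := congrFun hfl l
        by_cases hl : l = idx x
        · simp only [mesh, hl, if_true] at hl'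
          rw [hl]
          refine (abs_sub_lt_of_floor_div_eq hs hl' ?_).le
          have h1 := Int.fract_lt_one (x (idx x) / s)
          have h2 := Int.fract_lt_one (y (idx x) / s)
          rw [abs_lt]; constructor <;> linarith
        · simp only [mesh, hl, if_false] at hl'
          refine (abs_sub_lt_of_floor_div_eq hρ0 hl' ?_).le
          rw [div_self hρ0.ne']
          exact abs_lt.2 ⟨by linarith [Int.fract_nonneg (x l / ρ), Int.fract_lt_one (y l / ρ)],
            by linarith [Int.fract_lt_one (x l / ρ), Int.fract_nonneg (y l / ρ)]⟩
      refine (EuclideanSpace.dist_le_card_mul hle).trans (le_of_eq ?_)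
      rw [hρ, Fintype.card_fin]; field_simp
  refine hmain.trans ?_
  rw [← ENNReal.ofReal_natCast]
  refine ENNReal.ofReal_le_ofReal (hcard.trans ?_)
  have hb2 : (2 * b + 1 : ℝ) ≤ (2 * R + 5) * d / r := by
    have : R / ρ = R * d / r := by rw [hρ]; field_simp
    rw [this] at hbR'
    have h5 : 1 ≤ d / r := (one_le_div hr).2 (hr1.trans hd')
    have h6 : (2 * R + 5) * d / r = 2 * (R * d / r) + 5 * (d / r) := by ring
    rw [h6]; linarith
  calc (d * ((2 * a + 1) * (2 * b + 1) ^ (d - 1)) : ℝ)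
      ≤ d * ((2 * a + 1) * ((2 * R + 5) * d / r) ^ (d - 1)) := by gcongr
    _ = _ := by rw [div_pow]; ring

/-- A continuous staircase, equal to the floor outside small left neighbourhoods of `ℤ`. -/
lemma exists_continuous_staircase (δ : ℝ) (hδ : 0 < δ) (hδ1 : δ ≤ 1) :
    ∃ p : ℝ → ℝ, Continuous p ∧ (∀ t, |p t - t| ≤ 1) ∧
      ∀ t, Int.fract t ≤ 1 - δ → p t = ⌊t⌋ := by
  let h : ℝ → ℝ := fun u => max 0 (1 - (1 - u) / δ) - u
  have hc : Continuous (h ∘ Int.fract) := by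
    refine ContinuousOn.comp_fract'' (by fun_prop) ?_
    have : 1 - 1 / δ ≤ 0 := by rw [sub_nonpos]; exact (one_le_div hδ).2 hδ1
    simpa [h] using this
  refine ⟨fun t => t + h (Int.fract t), continuous_id.add hc, fun t => ?_, fun t ht => ?_⟩
  · have h0 := Int.fract_nonneg t
    have h1 := Int.fract_lt_one t
    have h2 : max 0 (1 - (1 - Int.fract t) / δ) ≤ 1 := by
      refine max_le zero_le_one ?_
      have : 0 ≤ (1 - Int.fract t) / δ := div_nonneg (by linarith) hδ.le
      linarith
    have h3 := le_max_left 0 (1 - (1 - Int.fract t) / δ)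
    rw [add_sub_cancel_left, abs_le]
    constructor <;> simp only [h] <;> linarith
  · have : 1 - (1 - Int.fract t) / δ ≤ 0 := by
      rw [sub_nonpos, one_le_div hδ]; linarith
    simp only [h]
    rw [max_eq_left this]
    linarith [Int.floor_add_fract t]

/-- Every continuous function is uniformly close on a given compact set to one taking finitely many
values there off a set which is small at some scale. -/
lemma exists_finite_valued_approx (d : ℕ) (hd : 0 < d) (Ω : Set (EuclideanSpace ℝ (Fin d)))
    (ψ : ℝ → ℝ) (hψd : ∀ ε : ℝ, 0 < ε → ∃ᶠ r in 𝓝[>] (0:ℝ), ψ r / r ^ (d - 1) < ε)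
    (f : C(Ω, ℝ)) {K : Set Ω} (hK : IsCompact K) {ε : ℝ} (hε : 0 < ε) :
    ∃ (g : C(Ω, ℝ)) (A : Set (EuclideanSpace ℝ (Fin d))) (r : ℝ) (T : Finset ℝ),
      0 < r ∧ r < ε ∧ coverNum r A * ENNReal.ofReal (ψ r) ≤ ENNReal.ofReal ε ∧
      (∀ x ∈ K, dist (f x) (g x) < ε) ∧
      ∀ x ∈ K, (x : EuclideanSpace ℝ (Fin d)) ∉ A → g x ∈ T := by
  classical
  have hd0 : (0 : ℝ) < d := by exact_mod_cast hd
  obtain ⟨F, hF⟩ : ∃ F : C(EuclideanSpace ℝ (Fin d), ℝ), ∀ x ∈ K, F x = f x := by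
    have := isCompact_iff_compactSpace.1 hK
    have he : IsClosedEmbedding (fun x : K => ((x : Ω) : EuclideanSpace ℝ (Fin d))) :=
      Continuous.isClosedEmbedding (by fun_prop)
        (Subtype.val_injective.comp Subtype.val_injective)
    obtain ⟨F, hF⟩ := ContinuousMap.exists_extension he
      (f.comp ⟨Subtype.val, continuous_subtype_val⟩)
    exact ⟨F, fun x hx => DFunLike.congr_fun hF ⟨x, hx⟩⟩
  have hK' : IsCompact ((↑) '' K : Set (EuclideanSpace ℝ (Fin d))) :=
    hK.image continuous_subtype_val
  obtain ⟨R, hR0, hR⟩ : ∃ R : ℝ, 0 ≤ R ∧ ∀ x ∈ K, ∀ l, |(x : EuclideanSpace ℝ (Fin d)) l| ≤ R := by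
    obtain ⟨R, hR⟩ := hK'.isBounded.exists_norm_le
    refine ⟨max R 0, le_max_right _ _, fun x hx l => ?_⟩
    have := PiLp.norm_apply_le (x : EuclideanSpace ℝ (Fin d)) l
    rw [Real.norm_eq_abs] at this
    exact this.trans ((hR _ (mem_image_of_mem _ hx)).trans (le_max_left _ _))
  obtain ⟨η, hη, hFη⟩ := Metric.mem_uniformity_dist.1
    (hK'.uniformContinuousAt_of_continuousAt F (fun a _ => F.continuous.continuousAt)
      (Metric.dist_mem_uniformity hε))
  set s : ℝ := η / (2 * d) with hs_def
  have hs : 0 < s := by positivity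
  obtain ⟨C, hC, hcov⟩ := exists_coverNum_grid_le d hd R s hR0 hs
  obtain ⟨r, hr, hr0, hr'⟩ : ∃ r, ψ r / r ^ (d - 1) < ε / C ∧ 0 < r ∧ r < min ε (min 1 (s * d)) := by
    have h0 : (0 : ℝ) < min ε (min 1 (s * d)) := by positivity
    exact ((hψd (ε / C) (by positivity)).and_eventually (Ioo_mem_nhdsGT h0)).exists
  obtain ⟨hrε, hr1, hrs⟩ : r < ε ∧ r < 1 ∧ r < s * d := by simpa using hr'
  obtain ⟨p, hpc, hp1, hp⟩ := exists_continuous_staircase (r / d / s) (by positivity)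
    (by rw [div_div, mul_comm, div_le_one (by positivity)]; exact hrs.le)
  let Φ : EuclideanSpace ℝ (Fin d) → EuclideanSpace ℝ (Fin d) := fun x =>
    WithLp.toLp 2 fun l => s * p (x l / s)
  have hΦ : Continuous Φ := by fun_prop
  obtain ⟨a, ha⟩ := exists_nat_ge (R / s + 1)
  refine ⟨⟨fun x => F (Φ x), by fun_prop⟩,
    {x | (∀ l, |x l| ≤ R) ∧ ∃ i, 1 - r / d / s < Int.fract (x i / s)}, r,
    (Fintype.piFinset fun _ : Fin d => Finset.Icc (-(a : ℤ)) a).image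
      (fun k => F (WithLp.toLp 2 fun l => s * (k l : ℝ))),
    hr0, hrε, ?_, fun x hx => ?_, fun x hx hxA => ?_⟩
  · calc _ ≤ ENNReal.ofReal (C / r ^ (d - 1)) * ENNReal.ofReal (ψ r) := by
          gcongr; exact hcov r hr0 hr1.le
      _ = ENNReal.ofReal (C * (ψ r / r ^ (d - 1))) := by
          rw [← ENNReal.ofReal_mul (by positivity)]; congr 1; ring
      _ ≤ ENNReal.ofReal ε := by
          refine ENNReal.ofReal_le_ofReal ?_
          rw [lt_div_iff₀ hC] at hr
          linarith
  · rw [← hF x hx]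
    refine hFη (a := (x : EuclideanSpace ℝ (Fin d))) ?_ (mem_image_of_mem _ hx)
    rw [dist_comm]
    have : ∀ l, |Φ x l - (x : EuclideanSpace ℝ (Fin d)) l| ≤ s := by
      intro l
      have h1 := hp1 ((x : EuclideanSpace ℝ (Fin d)) l / s)
      have h2 : Φ x l - (x : EuclideanSpace ℝ (Fin d)) l =
          s * (p ((x : EuclideanSpace ℝ (Fin d)) l / s) - (x : EuclideanSpace ℝ (Fin d)) l / s) := by
        simp only [Φ]; field_simp
      rw [h2, abs_mul, abs_of_pos hs]
      nlinarith
    refine (EuclideanSpace.dist_le_card_mul this).trans_lt ?_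
    rw [Fintype.card_fin, hs_def]
    have : d * (η / (2 * d)) = η / 2 := by field_simp
    rw [this]; linarith
  · have hfr : ∀ l, Int.fract ((x : EuclideanSpace ℝ (Fin d)) l / s) ≤ 1 - r / d / s := by
      intro l
      by_contra! hcon
      exact hxA ⟨hR x hx, l, hcon⟩
    refine Finset.mem_image.2 ⟨fun l => ⌊(x : EuclideanSpace ℝ (Fin d)) l / s⌋, ?_, ?_⟩
    · exact Fintype.mem_piFinset.2 fun l => floor_mem_Icc_neg hs (hR x hx l) ha
    · have : Φ x = WithLp.toLp 2 fun l => s * (⌊(x : EuclideanSpace ℝ (Fin d)) l / s⌋ : ℝ) := by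
        ext l
        simp only [Φ]
        rw [hp _ (hfr l)]
      simp [this]

/-- On `K`, off a set which is `ψ`-small at some scale below `ε`, the function `f` takes values in
finitely many intervals that are `ξ`-small. -/
def SplitsAt {d : ℕ} {Ω : Set (EuclideanSpace ℝ (Fin d))} (ξ ψ : ℝ → ℝ) (K : Set Ω) (ε : ℝ)
    (f : C(Ω, ℝ)) : Prop :=
  ∃ (A : Set (EuclideanSpace ℝ (Fin d))) (r : ℝ) (T : Finset ℝ) (η : ℝ),
    0 < r ∧ r < ε ∧ coverNum r A * ENNReal.ofReal (ψ r) ≤ ENNReal.ofReal ε ∧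
    0 < η ∧ η < ε ∧ T.card * ENNReal.ofReal (ξ η) ≤ ENNReal.ofReal ε ∧
    ∀ x ∈ K, (x : EuclideanSpace ℝ (Fin d)) ∉ A → ∃ c ∈ T, dist (f x) c ≤ η / 2

lemma IsGauge.exists_mul_le {ξ : ℝ → ℝ} (hξ : IsGauge ξ) (N : ℕ) {ε : ℝ} (hε : 0 < ε) :
    ∃ η, 0 < η ∧ η < ε ∧ N * ENNReal.ofReal (ξ η) ≤ ENNReal.ofReal ε := by
  have h1 : Tendsto ξ (𝓝[>] 0) (𝓝 0) := by
    have := (hξ.2.1 0 le_rfl).tendsto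
    rw [hξ.2.2.1] at this
    exact this.mono_left (nhdsWithin_mono _ Ioi_subset_Ici_self)
  have h2 : ∀ᶠ η in 𝓝[>] (0 : ℝ), N * ξ η < ε :=
    (h1.const_mul (N : ℝ)).eventually_lt_const (by simpa using hε)
  obtain ⟨η, hη, hη0, hηε⟩ := (h2.and (Ioo_mem_nhdsGT hε)).exists
  refine ⟨η, hη0, hηε, ?_⟩
  rw [← ENNReal.ofReal_natCast, ← ENNReal.ofReal_mul (by positivity)]
  exact ENNReal.ofReal_le_ofReal hη.le

lemma eventually_residual_splitsAt (d : ℕ) (hd : 0 < d) (Ω : Set (EuclideanSpace ℝ (Fin d)))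
    (ξ ψ : ℝ → ℝ) (hξ : IsGauge ξ)
    (hψd : ∀ ε : ℝ, 0 < ε → ∃ᶠ r in 𝓝[>] (0:ℝ), ψ r / r ^ (d - 1) < ε)
    {K : Set Ω} (hK : IsCompact K) {ε : ℝ} (hε : 0 < ε) :
    ∀ᶠ f : C(Ω, ℝ) in residual C(Ω, ℝ), SplitsAt ξ ψ K ε f := by
  refine mem_of_superset (residual_of_dense_open (isOpen_interior (s := {f | SplitsAt ξ ψ K ε f}))
    fun f => ?_) interior_subset
  refine (mem_closure_iff_nhds_basis
    (nhds_basis_uniformity' ContinuousMap.hasBasis_compactConvergenceUniformity)).2 ?_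
  rintro ⟨L, V⟩ ⟨hL, hV⟩
  obtain ⟨ε₁, hε₁, hVε⟩ := Metric.mem_uniformity_dist.1 hV
  obtain ⟨g, A, r, T, hr0, hr, hcov, hfg, hT⟩ := exists_finite_valued_approx d hd Ω ψ hψd f
    (hK.union hL) (lt_min hε hε₁)
  refine ⟨g, ?_, fun x hx => hVε ((hfg x (Or.inr hx)).trans_le (min_le_right _ _))⟩
  obtain ⟨η, hη0, hηε, hTη⟩ := hξ.exists_mul_le T.card hε
  refine mem_interior_iff_mem_nhds.2 ?_
  refine (nhds_basis_uniformity' ContinuousMap.hasBasis_compactConvergenceUniformity).mem_iff.2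
    ⟨⟨K, _⟩, ⟨hK, Metric.dist_mem_uniformity (half_pos hη0)⟩, fun h hh => ?_⟩
  refine ⟨A, r, T, η, hr0, hr.trans_le (min_le_left _ _),
    hcov.trans (ENNReal.ofReal_le_ofReal (min_le_left _ _)), hη0, hηε, hTη, fun x hx hxA =>
    ⟨g x, hT x (Or.inl hx) hxA, ?_⟩⟩
  rw [dist_comm]
  exact (hh x hx).le

lemma nu0_eq_zero {X : Type*} [PseudoMetricSpace X] {ψ : ℝ → ℝ} {E : Set X} {r : ℕ → ℝ}
    (hr : Tendsto r atTop (𝓝[>] 0)) {e : ℕ → ℝ≥0∞} (he : Tendsto e atTop (𝓝 0))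
    (hE : ∀ᶠ n in atTop, coverNum (r n) E * ENNReal.ofReal (ψ (r n)) ≤ e n) :
    nu0 ψ E = 0 := by
  refine le_antisymm ?_ zero_le
  calc nu0 ψ E ≤ liminf (fun δ => coverNum δ E * ENNReal.ofReal (ψ δ)) (map r atTop) :=
        liminf_le_liminf_of_le hr
    _ = liminf (fun n => coverNum (r n) E * ENNReal.ofReal (ψ (r n))) atTop := rfl
    _ ≤ liminf e atTop := liminf_le_liminf hE
    _ = 0 := he.liminf_eq

/-- Countable covers indexed by an arbitrary encodable type bound the premeasure of `H^ξ`. -/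
lemma iInf_cover_le_tsum {X ι : Type*} [PseudoMetricSpace X] [Encodable ι] {ξ : ℝ → ℝ}
    (h0 : ξ 0 = 0) {E : Set X} {δ : ℝ} (s : ι → Set X) (hE : E ⊆ ⋃ i, s i)
    (hs : ∀ i, Metric.ediam (s i) ≤ ENNReal.ofReal δ) :
    (⨅ (G : ℕ → Set X) (_ : E ⊆ ⋃ n, G n) (_ : ∀ n, Metric.ediam (G n) ≤ ENNReal.ofReal δ),
      ∑' n, ENNReal.ofReal (ξ (Metric.ediam (G n)).toReal)) ≤
    ∑' i, ENNReal.ofReal (ξ (Metric.ediam (s i)).toReal) := by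
  rw [← tsum_iUnion_decode₂ (fun S : Set X => ENNReal.ofReal (ξ (Metric.ediam S).toReal))
    (by simp [h0]) s]
  refine iInf_le_of_le (fun n => ⋃ b ∈ Encodable.decode₂ ι n, s b)
    (iInf₂_le (by rwa [Encodable.iUnion_decode₂]) fun n => ?_)
  exact Encodable.iUnion_decode₂_cases (C := fun S => Metric.ediam S ≤ ENNReal.ofReal δ)
    (by simp) hs

/-- A set of reals covered infinitely often by finite families of intervals with summable gauges is
`H^ξ`-null. -/
lemma hausdorffGauge_eq_zero {ξ : ℝ → ℝ} (hξ : IsGauge ξ) {E : Set ℝ} {T : ℕ → Finset ℝ}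
    {η : ℕ → ℝ} {e : ℕ → ℝ≥0∞} (hη : Tendsto η atTop (𝓝 0)) (hη0 : ∀ n, 0 < η n)
    (he : ∑' n, e n ≠ ⊤) (hT : ∀ n, (T n).card * ENNReal.ofReal (ξ (η n)) ≤ e n)
    (hE : ∀ y ∈ E, ∃ᶠ n in atTop, ∃ c ∈ T n, dist y c ≤ η n / 2) :
    hausdorffGauge ξ E = 0 := by
  refine le_antisymm (iSup₂_le fun δ hδ => ?_) zero_le
  have htail : Tendsto (fun m => ∑' n, e (n + m)) atTop (𝓝 0) :=
    ENNReal.tendsto_sum_nat_add e he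
  refine ge_of_tendsto htail ?_
  obtain ⟨N, hN⟩ := eventually_atTop.1 (hη.eventually_lt_const hδ)
  filter_upwards [eventually_ge_atTop N] with m hm
  let s : (Σ n : ℕ, T (n + m)) → Set ℝ := fun i => Metric.closedBall (i.2 : ℝ) (η (i.1 + m) / 2)
  have hdiam : ∀ i, Metric.ediam (s i) = ENNReal.ofReal (η (i.1 + m)) := by
    intro i
    simp only [s]
    rw [Real.closedBall_eq_Icc, Real.ediam_Icc]
    congr 1
    ring
  have : Encodable (Σ n : ℕ, T (n + m)) := Encodable.ofCountable _
  refine (iInf_cover_le_tsum hξ.2.2.1 s (fun y hy => ?_) fun i => ?_).trans ?_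
  · obtain ⟨n, hn, c, hc, hyc⟩ := frequently_atTop.1 (hE y hy) m
    obtain ⟨k, rfl⟩ := Nat.exists_eq_add_of_le' hn
    exact mem_iUnion.2 ⟨⟨k, c, hc⟩, hyc⟩
  · rw [hdiam]
    exact ENNReal.ofReal_le_ofReal (hN _ (by omega)).le
  · rw [ENNReal.tsum_sigma']
    refine ENNReal.tsum_le_tsum fun n => ?_
    refine le_trans (le_of_eq ?_) (hT (n + m))
    simp only [hdiam, ENNReal.toReal_ofReal (hη0 _).le]
    simp

theorem stmt6
    (d : ℕ) (hd : 0 < d) (Ω : Set (EuclideanSpace ℝ (Fin d)))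
    (hΩ : LocallyCompactSpace Ω)
    (ξ ψ : ℝ → ℝ) (hξ : IsGauge ξ) (hψ : IsGauge ψ)
    (hψd : ∀ ε : ℝ, 0 < ε → ∃ᶠ r in 𝓝[>] (0:ℝ), ψ r / r ^ (d - 1) < ε) :
    ∀ᶠ f : C(↥Ω, ℝ) in residual C(↥Ω, ℝ),
      ∃ A B : Set (EuclideanSpace ℝ (Fin d)),
        A ∪ B = Ω ∧ Disjoint A B ∧
        lowerBoxMeasure ψ A = 0 ∧
        hausdorffGauge ξ (⇑f '' {x : ↥Ω | (x : EuclideanSpace ℝ (Fin d)) ∈ B}) = 0 := by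
  classical
  have hpos : ∀ n : ℕ, (0 : ℝ) < (1 / 2) ^ n := fun n => by positivity
  have hlim : Tendsto (fun n : ℕ => ((1 : ℝ) / 2) ^ n) atTop (𝓝 0) :=
    tendsto_pow_atTop_nhds_zero_of_lt_one (by norm_num) (by norm_num)
  have hall : ∀ᶠ f : C(Ω, ℝ) in residual C(Ω, ℝ), ∀ n : ℕ,
      SplitsAt ξ ψ (compactCovering Ω n) ((1 / 2) ^ n) f :=
    eventually_countable_forall.2 fun n =>
      eventually_residual_splitsAt d hd Ω ξ ψ hξ hψd (isCompact_compactCovering Ω n) (hpos n)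
  filter_upwards [hall] with f hf
  choose A r T η hr0 hr hcov hη0 hη hT hA using hf
  let S : Set (EuclideanSpace ℝ (Fin d)) := {x ∈ Ω | ∀ᶠ n in atTop, x ∈ A n}
  refine ⟨S, Ω \ S, union_sdiff_cancel fun x hx => hx.1, disjoint_sdiff_right, ?_, ?_⟩
  · refine le_antisymm ?_ zero_le
    refine iInf₂_le_of_le (fun m => ⋂ n ≥ m, A n) (fun x hx => ?_) (le_of_eq ?_)
    · obtain ⟨m, hm⟩ := eventually_atTop.1 hx.2
      exact mem_iUnion.2 ⟨m, mem_iInter₂.2 hm⟩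
    · refine ENNReal.tsum_eq_zero.2 fun m => ?_
      refine nu0_eq_zero (r := r) (e := fun n => ENNReal.ofReal ((1 / 2) ^ n)) ?_ ?_ ?_
      · exact tendsto_nhdsWithin_iff.2 ⟨squeeze_zero (fun n => (hr0 n).le) (fun n => (hr n).le) hlim,
          Eventually.of_forall hr0⟩
      · simpa using ENNReal.tendsto_ofReal hlim
      · filter_upwards [eventually_ge_atTop m] with n hn
        refine le_trans ?_ (hcov n)
        gcongr
        exact coverNum_mono (biInter_subset_of_mem hn)
  · refine hausdorffGauge_eq_zero hξ (T := T) (η := η) (e := fun n => ENNReal.ofReal ((1 / 2) ^ n))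
      (squeeze_zero (fun n => (hη0 n).le) (fun n => (hη n).le) hlim) hη0 ?_ hT ?_
    · rw [← ENNReal.ofReal_tsum_of_nonneg (fun n => (hpos n).le) summable_geometric_two]
      exact ENNReal.ofReal_ne_top
    · rintro _ ⟨x, ⟨hxΩ, hxS⟩, rfl⟩
      have hxA : ∃ᶠ n in atTop, (x : EuclideanSpace ℝ (Fin d)) ∉ A n := fun h =>
        hxS ⟨hxΩ, by simpa using h⟩
      obtain ⟨j, hj⟩ := mem_iUnion.1 ((iUnion_compactCovering Ω).symm ▸ mem_univ x)
      refine (hxA.and_eventually (eventually_ge_atTop j)).mono fun n hn => ?_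
      exact hA n x (compactCovering_subset Ω hn.2 hj) hn.1
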